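/- Let a : ℕ → ℝ with a_n > 0 for all n and b : ℕ → ℂ, and suppose the maximal Jacobi operator J(a,b) is proper. Then the block operator 𝐉 on the Hilbert space ℓ²(ℕ₀) ⊕ ℓ²(ℕ₀), with domain D(J(a,b*)) ⊕ D(J(a,b)) and action 𝐉(u ⊕ v) = (J(a,b)v) ⊕ (J(a,b*)u), is self-adjoint: 𝐉 equals its Hilbert-space adjoint. -/

import Mathlib

open scoped InnerProductSpace ComplexConjugate

noncomputable section

/-- The Hilbert space `ℓ²(ℕ₀)` of square-summable complex sequences. -/
abbrev H : Type := lp (fun _ : ℕ => ℂ) 2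

/-- The formal Jacobi action: `(Ju)ₙ = aₙ₋₁uₙ₋₁ + bₙuₙ + aₙuₙ₊₁` (with `u₋₁ = 0`). -/
def jacobiAct (a : ℕ → ℝ) (b : ℕ → ℂ) (u : ℕ → ℂ) : ℕ → ℂ := fun n =>
  (if n = 0 then 0 else (a (n - 1) : ℂ) * u (n - 1)) + b n * u n + (a n : ℂ) * u (n + 1)

lemma jacobiAct_add (a : ℕ → ℝ) (b : ℕ → ℂ) (u v : ℕ → ℂ) :
    jacobiAct a b (u + v) = jacobiAct a b u + jacobiAct a b v := by
  funext n
  by_cases h : n = 0 <;> simp [jacobiAct, h] <;> ring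

lemma jacobiAct_smul (a : ℕ → ℝ) (b : ℕ → ℂ) (c : ℂ) (u : ℕ → ℂ) :
    jacobiAct a b (c • u) = c • jacobiAct a b u := by
  funext n
  by_cases h : n = 0 <;> simp [jacobiAct, h] <;> ring

lemma jacobiAct_zero (a : ℕ → ℝ) (b : ℕ → ℂ) : jacobiAct a b 0 = 0 := by
  funext n
  by_cases h : n = 0 <;> simp [jacobiAct, h]

/-- The domain of the maximal Jacobi operator: all `u ∈ ℓ²` whose formal Jacobi action is
again in `ℓ²`. -/
def jacobiDomain (a : ℕ → ℝ) (b : ℕ → ℂ) : Submodule ℂ H where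
  carrier := {u : H | Memℓp (jacobiAct a b ⇑u) 2}
  zero_mem' := by
    show Memℓp (jacobiAct a b 0) 2
    rw [jacobiAct_zero]
    exact zero_memℓp (E := fun _ : ℕ => ℂ) (p := 2)
  add_mem' := by
    intro u v hu hv
    show Memℓp (jacobiAct a b (⇑u + ⇑v)) 2
    rw [jacobiAct_add]
    exact hu.add hv
  smul_mem' := by
    intro c u hu
    simpa [lp.coeFn_smul, jacobiAct_smul] using hu.const_smul c

/-- The maximal Jacobi operator `J(a,b)`, as a partially defined linear operator on
`ℓ²(ℕ₀)`. -/
def jacobiOp (a : ℕ → ℝ) (b : ℕ → ℂ) : H →ₗ.[ℂ] H where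
  domain := jacobiDomain a b
  toFun :=
    { toFun := fun u => (⟨jacobiAct a b ⇑(u : H), u.2⟩ : H)
      map_add' := by
        intro u v
        apply Subtype.ext
        exact jacobiAct_add a b _ _
      map_smul' := by
        intro c u
        apply Subtype.ext
        exact jacobiAct_smul a b c _ }

/-- The subspace `ℓ²_c(ℕ₀)` of finitely supported sequences. -/
def finSupp : Submodule ℂ H where
  carrier := {u : H | (Function.support ⇑u).Finite}
  zero_mem' := by simp [Function.support]
  add_mem' := by
    intro u v hu hv
    refine Set.Finite.subset (hu.union hv) ?_
    intro n hn
    simp only [Function.mem_support, lp.coeFn_add, Pi.add_apply] at hn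
    by_contra hc
    simp only [Set.mem_union, Function.mem_support, not_or, not_not] at hc
    exact hn (by rw [hc.1, hc.2, add_zero])
  smul_mem' := by
    intro c u hu
    refine Set.Finite.subset hu ?_
    intro n hn
    simp only [Function.mem_support, lp.coeFn_smul, Pi.smul_apply, smul_eq_mul] at hn
    simp only [Function.mem_support]
    intro h
    exact hn (by rw [h, mul_zero])

lemma finSupp_memℓp (a : ℕ → ℝ) (b : ℕ → ℂ) (u : ℕ → ℂ)
    (hu : (Function.support u).Finite) : Memℓp (jacobiAct a b u) 2 := by
  have hfin : (((· + 1) '' Function.support u ∪ Function.support u) ∪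
      ((· - 1) '' Function.support u)).Finite :=
    ((hu.image _).union hu).union (hu.image _)
  refine (memℓp_zero (hfin.subset ?_)).of_exponent_ge zero_le
  intro n hn
  simp only [Set.mem_setOf_eq, jacobiAct] at hn
  by_contra hc
  simp only [Set.mem_union, Set.mem_image, Function.mem_support, not_or, not_exists,
    not_and] at hc
  obtain ⟨⟨h1, h2⟩, h3⟩ := hc
  have e2 : u n = 0 := not_not.1 h2
  have e3 : u (n + 1) = 0 := by
    by_contra hne
    exact h3 (n + 1) hne (by omega)
  apply hn
  by_cases h : n = 0
  · subst h; simp [e2, show u 1 = 0 from e3]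
  · have e1 : u (n - 1) = 0 := by
      by_contra hne
      exact h1 (n - 1) hne (by omega)
    simp [h, e1, e2, e3]

/-- The minimal Jacobi operator `J₀(a,b)`: the restriction of the maximal operator to the
finitely supported sequences. -/
def jacobiOp₀ (a : ℕ → ℝ) (b : ℕ → ℂ) : H →ₗ.[ℂ] H where
  domain := finSupp
  toFun :=
    { toFun := fun u => (⟨jacobiAct a b ⇑(u : H), finSupp_memℓp a b _ u.2⟩ : H)
      map_add' := by
        intro u v
        apply Subtype.ext
        exact jacobiAct_add a b _ _
      map_smul' := by
        intro c u
        apply Subtype.ext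
        exact jacobiAct_smul a b c _ }

/-- The Wronskian `Wₙ(u,v) = aₙ(uₙ₊₁vₙ − uₙvₙ₊₁)`. -/
def wronskian (a : ℕ → ℝ) (u v : ℕ → ℂ) (n : ℕ) : ℂ :=
  (a n : ℂ) * (u (n + 1) * v n - u n * v (n + 1))


/-- The Hilbert space `ℓ²(ℕ₀) ⊕ ℓ²(ℕ₀)` (with the `ℓ²` product inner product). -/
abbrev H2 : Type := WithLp 2 (H × H)

/-- The domain `D(J(a,b*)) ⊕ D(J(a,b))` of the block operator `𝐉`. -/
def blockDomain (a : ℕ → ℝ) (b : ℕ → ℂ) : Submodule ℂ H2 :=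
  ((jacobiDomain a (fun n => conj (b n))).prod (jacobiDomain a b)).comap
    (WithLp.linearEquiv 2 ℂ (H × H)).toLinearMap

lemma blockDomain_fst {a : ℕ → ℝ} {b : ℕ → ℂ} {p : H2} (hp : p ∈ blockDomain a b) :
    (WithLp.equiv 2 (H × H) p).1 ∈ jacobiDomain a (fun n => conj (b n)) :=
  hp.1

lemma blockDomain_snd {a : ℕ → ℝ} {b : ℕ → ℂ} {p : H2} (hp : p ∈ blockDomain a b) :
    (WithLp.equiv 2 (H × H) p).2 ∈ jacobiDomain a b :=
  hp.2

/-- The self-adjoint block operator `𝐉` of a proper Jacobi matrix: it acts on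
`D(J(a,b*)) ⊕ D(J(a,b))` by `𝐉(u ⊕ v) = (J(a,b)v) ⊕ (J(a,b*)u)`. -/
def blockOp (a : ℕ → ℝ) (b : ℕ → ℂ) : H2 →ₗ.[ℂ] H2 where
  domain := blockDomain a b
  toFun :=
    { toFun := fun p =>
        (WithLp.equiv 2 (H × H)).symm
          (jacobiOp a b ⟨(WithLp.equiv 2 (H × H) (p : H2)).2, blockDomain_snd p.2⟩,
           jacobiOp a (fun n => conj (b n))
             ⟨(WithLp.equiv 2 (H × H) (p : H2)).1, blockDomain_fst p.2⟩)
      map_add' := by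
        intro p q
        apply (WithLp.equiv 2 (H × H)).injective
        ext n
        · exact congrFun (jacobiAct_add a b _ _) n
        · exact congrFun (jacobiAct_add a (fun n => conj (b n)) _ _) n
      map_smul' := by
        intro c p
        apply (WithLp.equiv 2 (H × H)).injective
        ext n <;>
          simp [jacobiOp, lp.coeFn_smul, jacobiAct_smul] }

/-- Partial sums of the Lagrange identity for the formal Jacobi action. -/
lemma sum_jacobiAct_sub (a : ℕ → ℝ) (b u v : ℕ → ℂ) (N : ℕ) :
    ∑ n ∈ Finset.range (N + 1),
      (⟪jacobiAct a b u n, v n⟫_ℂ - ⟪u n, jacobiAct a (fun n => conj (b n)) v n⟫_ℂ) =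
      wronskian a (fun n => conj (u n)) v N := by
  induction N with
  | zero => simp [jacobiAct, wronskian, RCLike.inner_apply]; ring
  | succ N ih =>
    rw [Finset.sum_range_succ, ih]
    simp [jacobiAct, wronskian, RCLike.inner_apply]
    ring

/-- The Green formula when one of the two sequences is finitely supported. -/
lemma eq_tsum_of_hasSum_jacobiAct {a : ℕ → ℝ} {b u v : ℕ → ℂ} {s : ℂ}
    (hu : (Function.support u).Finite)
    (hs : HasSum (fun n => ⟪jacobiAct a b u n, v n⟫_ℂ) s) :
    s = ∑' n, ⟪u n, jacobiAct a (fun n => conj (b n)) v n⟫_ℂ := by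
  obtain ⟨N, hN⟩ := hu.bddAbove
  have hzero : ∀ n, N < n → u n = 0 := fun n hn => by
    by_contra h
    exact absurd (hN h) (not_le.2 hn)
  have hsum : Summable fun n => ⟪u n, jacobiAct a (fun n => conj (b n)) v n⟫_ℂ :=
    summable_of_ne_finset_zero (s := Finset.range (N + 1)) fun n hn => by
      rw [hzero n (by simpa using hn), inner_zero_left]
  have hdiff := (hs.sub hsum.hasSum).tendsto_sum_nat
  rw [← sub_eq_zero]
  refine tendsto_nhds_unique hdiff (tendsto_const_nhds.congr' ?_)
  filter_upwards [Filter.eventually_gt_atTop (N + 1)] with k hk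
  obtain ⟨m, rfl⟩ : ∃ m, k = m + 1 := ⟨k - 1, by omega⟩
  rw [sum_jacobiAct_sub]
  simp [wronskian, hzero m (by omega), hzero (m + 1) (by omega)]

lemma inner_jacobiAct_left {a : ℕ → ℝ} {b : ℕ → ℂ} {u w : H}
    (hu : (Function.support ⇑u).Finite) (hw : ⇑w = jacobiAct a b ⇑u) (v : H) :
    ⟪w, v⟫_ℂ = ∑' n, ⟪u n, jacobiAct a (fun n => conj (b n)) ⇑v n⟫_ℂ := by
  have hs := lp.hasSum_inner (𝕜 := ℂ) w v
  rw [hw] at hs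
  exact eq_tsum_of_hasSum_jacobiAct hu hs

lemma single_mem_finSupp (n : ℕ) (c : ℂ) : lp.single 2 n c ∈ finSupp := by
  refine (Set.finite_singleton n).subset fun m hm => ?_
  by_contra h
  exact hm (lp.single_apply_ne (E := fun _ : ℕ => ℂ) 2 n c h)

lemma finSupp_le_jacobiDomain (a : ℕ → ℝ) (b : ℕ → ℂ) : finSupp ≤ jacobiDomain a b :=
  fun u hu => finSupp_memℓp a b u hu

lemma inner_jacobiOp_single (a : ℕ → ℝ) (b : ℕ → ℂ) (n : ℕ) (v : H) :
    ⟪jacobiOp a b ⟨lp.single 2 n 1, finSupp_le_jacobiDomain a b (single_mem_finSupp n 1)⟩,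
      v⟫_ℂ = jacobiAct a (fun n => conj (b n)) v n := by
  rw [inner_jacobiAct_left (single_mem_finSupp n 1) rfl, tsum_eq_single n]
  · simp [RCLike.inner_apply]
  · intro m hm
    have hz := lp.single_apply_ne (E := fun _ : ℕ => ℂ) 2 n 1 hm
    exact (congrArg (fun z : ℂ => ⟪z, jacobiAct a (fun n => conj (b n)) v m⟫_ℂ) hz).trans
      (inner_zero_left _)

/-- The graph of the closure of a partial operator lies in the closure of its graph, whether or
not the operator is closable. -/
lemma graph_closure_le_topologicalClosure (f : H →ₗ.[ℂ] H) :
    f.closure.graph ≤ f.graph.topologicalClosure := by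
  by_cases hf : f.IsClosable
  · exact hf.graph_closure_eq_closure_graph.ge
  · rw [LinearPMap.closure_def' hf]
    exact f.graph.le_topologicalClosure

/-- For a proper Jacobi operator, `J(a,b)` and `J(a,b*)` are formal adjoints of each other. -/
lemma jacobiOp_isFormalAdjoint {a : ℕ → ℝ} {b : ℕ → ℂ}
    (hproper : (jacobiOp₀ a b).closure = jacobiOp a b) :
    (jacobiOp a b).IsFormalAdjoint (jacobiOp a (fun n => conj (b n))) := by
  intro u v
  have hclosed : IsClosed {p : H × H |
      ⟪p.2, (v : H)⟫_ℂ = ⟪p.1, jacobiOp a (fun n => conj (b n)) v⟫_ℂ} :=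
    isClosed_eq (by fun_prop) (by fun_prop)
  have hsub : ((jacobiOp₀ a b).graph : Set (H × H)) ⊆ {p : H × H |
      ⟪p.2, (v : H)⟫_ℂ = ⟪p.1, jacobiOp a (fun n => conj (b n)) v⟫_ℂ} := by
    intro p hp
    obtain ⟨x, hx₁, hx₂⟩ := (LinearPMap.mem_graph_iff _).1 hp
    rw [Set.mem_ofPred_eq, ← hx₁, ← hx₂, inner_jacobiAct_left x.2 rfl, lp.inner_eq_tsum]
    rfl
  have hmem : ((u : H), jacobiOp a b u) ∈ (jacobiOp₀ a b).graph.topologicalClosure := by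
    apply graph_closure_le_topologicalClosure
    rw [hproper]
    exact (jacobiOp a b).mem_graph u
  exact closure_minimal hsub hclosed hmem

lemma toLp_mem_blockDomain {a : ℕ → ℝ} {b : ℕ → ℂ} {u v : H} (hu : u ∈ finSupp)
    (hv : v ∈ finSupp) : WithLp.toLp 2 (u, v) ∈ blockDomain a b :=
  ⟨finSupp_le_jacobiDomain a _ hu, finSupp_le_jacobiDomain a b hv⟩

lemma dense_blockDomain (a : ℕ → ℝ) (b : ℕ → ℂ) : Dense (blockDomain a b : Set H2) := by
  rw [Submodule.dense_iff_topologicalClosure_eq_top, Submodule.topologicalClosure_eq_top_iff,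
    Submodule.eq_bot_iff]
  intro x hx
  rw [Submodule.mem_orthogonal] at hx
  apply (WithLp.equiv 2 (H × H)).injective
  ext n
  · simpa [WithLp.prod_inner_apply, lp.inner_single_left, RCLike.inner_apply] using
      hx _ (toLp_mem_blockDomain (single_mem_finSupp n 1) finSupp.zero_mem)
  · simpa [WithLp.prod_inner_apply, lp.inner_single_left, RCLike.inner_apply] using
      hx _ (toLp_mem_blockDomain finSupp.zero_mem (single_mem_finSupp n 1))

lemma inner_blockOp_left (a : ℕ → ℝ) (b : ℕ → ℂ) (p : (blockOp a b).domain) (q : H2) :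
    ⟪blockOp a b p, q⟫_ℂ =
      ⟪jacobiOp a b ⟨(WithLp.ofLp (p : H2)).2, blockDomain_snd p.2⟩, (WithLp.ofLp q).1⟫_ℂ +
      ⟪jacobiOp a (fun n => conj (b n)) ⟨(WithLp.ofLp (p : H2)).1, blockDomain_fst p.2⟩,
        (WithLp.ofLp q).2⟫_ℂ :=
  rfl

lemma blockOp_isFormalAdjoint {a : ℕ → ℝ} {b : ℕ → ℂ}
    (hproper : (jacobiOp₀ a b).closure = jacobiOp a b) :
    (blockOp a b).IsFormalAdjoint (blockOp a b) := by
  intro p q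
  have h := jacobiOp_isFormalAdjoint hproper
  rw [← inner_conj_symm (p : H2), inner_blockOp_left, inner_blockOp_left, map_add,
    inner_conj_symm, inner_conj_symm, add_comm]
  congr 1
  · exact h.symm ⟨_, blockDomain_fst p.2⟩ ⟨_, blockDomain_snd q.2⟩
  · exact h ⟨_, blockDomain_snd p.2⟩ ⟨_, blockDomain_fst q.2⟩

/-- The formal action is recovered from the adjoint of the block operator by testing against
the standard basis. -/
lemma jacobiAct_eq_of_mem_adjoint_domain {a : ℕ → ℝ} {b : ℕ → ℂ}
    (p : (blockOp a b).adjoint.domain) :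
    jacobiAct a b (WithLp.ofLp (p : H2)).2 = (WithLp.ofLp ((blockOp a b).adjoint p)).1 ∧
      jacobiAct a (fun n => conj (b n)) (WithLp.ofLp (p : H2)).1 =
        (WithLp.ofLp ((blockOp a b).adjoint p)).2 := by
  have h := (LinearPMap.adjoint_isFormalAdjoint (T := blockOp a b) (dense_blockDomain a b)).symm
  constructor
  · funext n
    have hn :
        ⟪jacobiOp a b 0, (WithLp.ofLp (p : H2)).1⟫_ℂ +
          ⟪jacobiOp a (fun n => conj (b n))
            ⟨lp.single 2 n 1, finSupp_le_jacobiDomain a _ (single_mem_finSupp n 1)⟩,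
            (WithLp.ofLp (p : H2)).2⟫_ℂ =
        ⟪(lp.single 2 n 1 : H), (WithLp.ofLp ((blockOp a b).adjoint p)).1⟫_ℂ +
          ⟪(0 : H), (WithLp.ofLp ((blockOp a b).adjoint p)).2⟫_ℂ :=
      h ⟨_, toLp_mem_blockDomain (single_mem_finSupp n 1) finSupp.zero_mem⟩ p
    rw [inner_jacobiOp_single, LinearPMap.map_zero, lp.inner_single_left] at hn
    simpa [RCLike.inner_apply] using hn
  · funext n
    have hn :
        ⟪jacobiOp a b ⟨lp.single 2 n 1, finSupp_le_jacobiDomain a b (single_mem_finSupp n 1)⟩,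
            (WithLp.ofLp (p : H2)).1⟫_ℂ +
          ⟪jacobiOp a (fun n => conj (b n)) 0, (WithLp.ofLp (p : H2)).2⟫_ℂ =
        ⟪(0 : H), (WithLp.ofLp ((blockOp a b).adjoint p)).1⟫_ℂ +
          ⟪(lp.single 2 n 1 : H), (WithLp.ofLp ((blockOp a b).adjoint p)).2⟫_ℂ :=
      h ⟨_, toLp_mem_blockDomain finSupp.zero_mem (single_mem_finSupp n 1)⟩ p
    rw [inner_jacobiOp_single, LinearPMap.map_zero, lp.inner_single_left] at hn
    simpa [RCLike.inner_apply] using hn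

lemma adjoint_domain_le_blockDomain (a : ℕ → ℝ) (b : ℕ → ℂ) :
    (blockOp a b).adjoint.domain ≤ blockDomain a b := by
  intro p hp
  obtain ⟨h₂, h₁⟩ := jacobiAct_eq_of_mem_adjoint_domain ⟨p, hp⟩
  constructor
  · change Memℓp (jacobiAct a (fun n => conj (b n)) (WithLp.ofLp p).1) 2
    rw [h₁]
    exact lp.memℓp _
  · change Memℓp (jacobiAct a b (WithLp.ofLp p).2) 2
    rw [h₂]
    exact lp.memℓp _

/-- **Self-adjointness of the block operator** (Section 4): if `J(a,b)` is proper, then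
the block operator `𝐉` on `ℓ²(ℕ₀) ⊕ ℓ²(ℕ₀)`, with domain `D(J(a,b*)) ⊕ D(J(a,b))` and
action `𝐉(u ⊕ v) = (J(a,b)v) ⊕ (J(a,b*)u)`, is self-adjoint. -/
theorem blockOp_selfAdjoint (a : ℕ → ℝ) (ha : ∀ n, 0 < a n) (b : ℕ → ℂ)
    (hproper : (jacobiOp₀ a b).closure = jacobiOp a b) :
    (blockOp a b).adjoint = blockOp a b := by
  have hle : blockOp a b ≤ (blockOp a b).adjoint :=
    (blockOp_isFormalAdjoint hproper).le_adjoint (dense_blockDomain a b)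
  exact (LinearPMap.eq_of_le_of_domain_eq hle
    (le_antisymm hle.1 (adjoint_domain_le_blockDomain a b))).symm

end
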